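/- Let G be a finite insoluble group. Then |Sol_G(x)| ≠ 6 for every element x ∈ G. -/

import Mathlib

def Sol {G : Type*} [Group G] (x : G) : Set G :=
  {y | IsSolvable ↥(Subgroup.closure {x, y})}

open Subgroup

theorem solv_sup {G : Type*} [Group G] (A B : Subgroup G) (hA : Group.IsSolvable A)
    (hB : Group.IsSolvable B) (h : B ≤ normalizer (A : Set G)) :
    Group.IsSolvable ↥(B ⊔ A) := by
  have := Subgroup.normal_subgroupOf_of_le_normalizer h
  have := Subgroup.normal_subgroupOf_sup_of_le_normalizer h
  rw [Group.isSolvable_iff_subgroup_quotient (A.subgroupOf (B ⊔ A))]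
  constructor
  · exact Group.isSolvable_of_isSolvable_injective
      (f := (Subgroup.subgroupOfEquivOfLe (le_sup_right : A ≤ B ⊔ A)).toMonoidHom)
      (Subgroup.subgroupOfEquivOfLe (le_sup_right : A ≤ B ⊔ A)).injective
  · exact Group.isSolvable_of_surjective
      (f := (QuotientGroup.quotientInfEquivProdNormalizerQuotient B A h).toMonoidHom)
      (QuotientGroup.quotientInfEquivProdNormalizerQuotient B A h).surjective

theorem solv_le {G : Type*} [Group G] {A B : Subgroup G} (hB : Group.IsSolvable B) (h : A ≤ B) :
    Group.IsSolvable A :=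
  Group.isSolvable_of_isSolvable_injective (Subgroup.inclusion_injective h)

theorem solv_top {G : Type*} [Group G] (h : Group.IsSolvable (⊤ : Subgroup G)) :
    Group.IsSolvable G :=
  Group.isSolvable_of_surjective (f := (Subgroup.topEquiv (G := G)).toMonoidHom)
    (Subgroup.topEquiv (G := G)).surjective

theorem solv_zpowers {G : Type*} [Group G] (x : G) : Group.IsSolvable (zpowers x) :=
  Group.isSolvable_of_comm (fun a b => mul_comm' a b)

theorem mem_Sol_of_le {G : Type*} [Group G] {x y : G} {H : Subgroup G} (hH : Group.IsSolvable H)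
    (hx : x ∈ H) (hy : y ∈ H) : y ∈ Sol x := by
  refine solv_le hH ?_
  rw [Subgroup.closure_le]
  rintro z (rfl | rfl)
  · exact hx
  · exact hy

theorem zpowers_le_norm {G : Type*} [Group G] [Finite G] {x y : G}
    (h : y * x * y⁻¹ ∈ zpowers x) : zpowers y ≤ normalizer (zpowers x : Set G) := by
  rw [Subgroup.zpowers_le]
  apply Subgroup.mem_normalizer_fintype
  rintro n hn
  obtain ⟨k, rfl⟩ := Subgroup.mem_zpowers_iff.1 hn
  rw [← conj_zpow]
  exact zpow_mem h k

theorem mem_Sol_of_norm {G : Type*} [Group G] [Finite G] {x y : G}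
    (h : y * x * y⁻¹ ∈ zpowers x) : y ∈ Sol x :=
  mem_Sol_of_le (solv_sup _ _ (solv_zpowers x) (solv_zpowers y) (zpowers_le_norm h))
    (le_sup_right (a := zpowers y) (mem_zpowers x)) (le_sup_left (b := zpowers x) (mem_zpowers y))

theorem mem_Sol_of_comm {G : Type*} [Group G] [Finite G] {x y : G}
    (h : y * x = x * y) : y ∈ Sol x :=
  mem_Sol_of_norm (by rw [h, mul_inv_cancel_right]; exact mem_zpowers x)

/-- Multiplying by powers of `x` on both sides preserves the solubilizer. -/
theorem Sol_mul {G : Type*} [Group G] {x y a b : G} (hy : y ∈ Sol x)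
    (ha : a ∈ zpowers x) (hb : b ∈ zpowers x) : a * y * b ∈ Sol x := by
  have hx : x ∈ closure {x, y} := subset_closure (by simp)
  have hy' : y ∈ closure {x, y} := subset_closure (by simp)
  have hz : zpowers x ≤ closure {x, y} := by rwa [zpowers_le]
  exact mem_Sol_of_le hy hx (mul_mem (mul_mem (hz ha) hy') (hz hb))

theorem Sol_anti {G : Type*} [Group G] {x y z : G} (hx : x ∈ zpowers z) (hy : y ∈ Sol z) :
    y ∈ Sol x := by
  have hz : z ∈ closure {z, y} := subset_closure (by simp)
  have hy' : y ∈ closure {z, y} := subset_closure (by simp)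
  have h : zpowers z ≤ closure {z, y} := by rwa [zpowers_le]
  exact mem_Sol_of_le hy (h hx) hy'

theorem burnside_compl {G : Type*} [Group G] [Finite G] (p : ℕ) [hp : Fact p.Prime] (x : G)
    (hx : orderOf x = p)
    (hC : ∀ g : G, g * x = x * g → (∃ n : ℕ, g ^ p ^ n = 1) → g ∈ zpowers x)
    (hN : ∀ g : G, g * x * g⁻¹ ∈ zpowers x → g * x = x * g) :
    ∃ K : Subgroup G, K.Normal ∧ Disjoint K (zpowers x) ∧ K ⊔ zpowers x = ⊤ := by
  have hpg : IsPGroup p (zpowers x) := IsPGroup.of_card (n := 1) (by simp [hx])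
  obtain ⟨P, hP⟩ := hpg.exists_le_sylow
  have hxP : x ∈ P := hP (mem_zpowers x)
  have hx1 : x ≠ 1 := by
    rintro rfl
    rw [orderOf_one] at hx
    exact hp.out.one_lt.ne hx
  have hPg := P.isPGroup'
  have : Nontrivial P := ⟨⟨⟨x, hxP⟩, 1, fun h => hx1 (congrArg Subtype.val h)⟩⟩
  have hpow : ∀ g ∈ P, ∃ n : ℕ, g ^ p ^ n = 1 := by
    intro g hg
    obtain ⟨n, hn⟩ := hPg ⟨g, hg⟩
    exact ⟨n, by simpa using congrArg Subtype.val hn⟩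
  have := hPg.center_nontrivial
  obtain ⟨⟨⟨z, hzP⟩, hzc⟩, hz1⟩ := exists_ne (1 : Subgroup.center P)
  have hz1' : z ≠ 1 := by
    rintro rfl
    exact hz1 rfl
  have hzc' : ∀ g ∈ P, g * z = z * g := fun g hg =>
    congrArg Subtype.val (Subgroup.mem_center_iff.1 hzc ⟨g, hg⟩)
  have hzx : z ∈ zpowers x := hC z (hzc' x hxP).symm (hpow z hzP)
  have hzz : zpowers z = zpowers x := by
    apply Subgroup.eq_of_le_of_card_ge
    · rwa [zpowers_le]
    · rw [Nat.card_zpowers, Nat.card_zpowers]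
      have h1 : orderOf z ∣ p := by rw [← hx]; exact orderOf_dvd_of_mem_zpowers hzx
      rcases (Nat.dvd_prime hp.out).1 h1 with h | h
      · exact absurd (orderOf_eq_one_iff.1 h) hz1'
      · rw [h, hx]
  have hxz : x ∈ zpowers z := hzz ▸ mem_zpowers x
  obtain ⟨k, hk⟩ := Subgroup.mem_zpowers_iff.1 hxz
  have hPx : (P : Subgroup G) = zpowers x := by
    apply le_antisymm _ hP
    intro g hg
    apply hC g _ (hpow g hg)
    rw [← hk]
    exact (Commute.zpow_right (hzc' g hg) k)
  have hNC : normalizer (P : Set G) ≤ centralizer (P : Set G) := by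
    intro g hg
    have hPx' : (P : Set G) = zpowers x := by
      rw [← hPx]; rfl
    rw [hPx'] at hg ⊢
    have h1 := hN g ((Subgroup.mem_normalizer_iff.1 hg x).1 (mem_zpowers x))
    rw [Subgroup.mem_centralizer_iff]
    intro h hh
    obtain ⟨j, rfl⟩ := Subgroup.mem_zpowers_iff.1 hh
    exact ((Commute.zpow_right (show Commute g x from h1) j)).symm
  have hc := MonoidHom.ker_transferSylow_isComplement' P hNC
  rw [← hPx]
  exact ⟨_, inferInstance, hc.disjoint, hc.sup_eq_top⟩

/-- A finite group with a fixed-point-free involutory endomorphism is solvable. -/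
theorem fpf2 {M : Type*} [Group M] [Finite M] (σ : M →* M) (h2 : ∀ m, σ (σ m) = m)
    (hf : ∀ m, σ m = m → m = 1) : Group.IsSolvable M := by
  have hinj : Function.Injective (fun m : M => m⁻¹ * σ m) := by
    intro a b hab
    have hab' : a⁻¹ * σ a = b⁻¹ * σ b := hab
    have : b * a⁻¹ = 1 := hf _ (by
      rw [map_mul, map_inv, ← mul_right_inj (b⁻¹), ← mul_assoc, ← hab']; group)
    exact (mul_inv_eq_one.1 this).symm
  have hsurj := Finite.surjective_of_injective hinj
  have hinv : ∀ m, σ m = m⁻¹ := by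
    intro m
    obtain ⟨a, rfl⟩ := hsurj m
    simp [h2]
  apply Group.isSolvable_of_comm
  intro a b
  have := hinv (b⁻¹ * a⁻¹)
  rw [map_mul, hinv, hinv] at this
  simpa using this.symm

theorem solv_comm_conj {M : Type*} [Group M] [Finite M]
    (h : ∀ a g : M, Commute a (g * a * g⁻¹)) : Group.IsSolvable M := by
  classical
  have key : ∀ a : M, Group.IsSolvable (normalClosure {a}) := by
    intro a
    apply Group.isSolvable_of_comm
    have hh : ∀ b c : M, b ∈ normalClosure {a} → c ∈ normalClosure {a} → Commute b c := by
      intro b c hb hc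
      unfold normalClosure at hb hc
      have hgen : ∀ u ∈ Group.conjugatesOfSet {a}, ∀ v ∈ Group.conjugatesOfSet {a},
          u * v = v * u := by
        intro u hu v hv
        rw [Group.mem_conjugatesOfSet_iff] at hu hv
        obtain ⟨_, hu', hu⟩ := hu
        obtain ⟨_, hv', hv⟩ := hv
        rw [Set.mem_singleton_iff.1 hu'] at hu
        rw [Set.mem_singleton_iff.1 hv'] at hv
        obtain ⟨g, rfl⟩ := isConj_iff.1 hu
        obtain ⟨k, rfl⟩ := isConj_iff.1 hv
        have := h (g * a * g⁻¹) (k * g⁻¹)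
        have e : k * g⁻¹ * (g * a * g⁻¹) * (k * g⁻¹)⁻¹ = k * a * k⁻¹ := by group
        rw [e] at this
        exact this
      have h2 : closure (Group.conjugatesOfSet {a}) ≤ centralizer (closure (Group.conjugatesOfSet {a}) : Set M) := by
        rw [Subgroup.centralizer_closure, closure_le]
        intro u hu
        rw [SetLike.mem_coe, mem_centralizer_iff]
        intro v hv
        exact hgen v hv u hu
      exact (mem_centralizer_iff.1 (h2 hc) b hb)
    intro b c
    exact Subtype.ext (hh b c b.2 c.2)
  have key2 : ∀ s : Finset M, ∃ N : Subgroup M, N.Normal ∧ Group.IsSolvable N ∧ ∀ a ∈ s, a ∈ N := by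
    intro s
    induction s using Finset.induction_on with
    | empty => exact ⟨⊥, inferInstance, inferInstance, by simp⟩
    | insert a s _ ih =>
      obtain ⟨N, hN, hs, hm⟩ := ih
      refine ⟨N ⊔ normalClosure {a}, inferInstance, solv_sup _ _ (key a) hs ?_, ?_⟩
      · rw [normalizer_eq_top]; exact le_top
      · intro b hb
        rcases Finset.mem_insert.1 hb with rfl | hb
        · exact le_sup_right (a := N) (subset_normalClosure (by simp))
        · exact le_sup_left (a := N) (hm b hb)
  cases nonempty_fintype M
  obtain ⟨N, hN, hs, hm⟩ := key2 Finset.univ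
  have : N = ⊤ := by
    rw [eq_top_iff]; intro a _; exact hm a (Finset.mem_univ a)
  subst this
  exact solv_top hs

theorem fpf_surj {M : Type*} [Group M] [Finite M] (σ : M →* M)
    (hf : ∀ m, σ m = m → m = 1) (m : M) : ∃ a, a⁻¹ * σ a = m := by
  have hinj : Function.Injective (fun m : M => m⁻¹ * σ m) := by
    intro a b hab
    have hab' : a⁻¹ * σ a = b⁻¹ * σ b := hab
    have : b * a⁻¹ = 1 := hf _ (by
      rw [map_mul, map_inv, ← mul_right_inj (b⁻¹), ← mul_assoc, ← hab']; group)
    exact (mul_inv_eq_one.1 this).symm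
  exact Finite.surjective_of_injective hinj m

/-- A finite group with a fixed-point-free endomorphism of order three is solvable. -/
theorem fpf3 {M : Type*} [Group M] [Finite M] (σ : M →* M) (h3 : ∀ m, σ (σ (σ m)) = m)
    (hf : ∀ m, σ m = m → m = 1) : Group.IsSolvable M := by
  have hn : ∀ m, m * σ m * σ (σ m) = 1 := by
    intro m
    obtain ⟨a, rfl⟩ := fpf_surj σ hf m
    simp [h3, mul_assoc]
  have hn2 : ∀ m, m * σ (σ m) * σ m = 1 := by
    intro m
    obtain ⟨a, rfl⟩ := fpf_surj (σ.comp σ) (fun m hm => hf m (by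
      have hm' : σ (σ m) = m := hm
      have := h3 m
      rwa [hm'] at this)) m
    simp [h3, mul_assoc]
  have hc : ∀ m, Commute m (σ m) := by
    intro m
    have h1 := hn m
    have h2 := hn2 m
    have h4 : σ (σ m) = σ m⁻¹ * m⁻¹ := by
      rw [mul_assoc] at h1
      have := eq_inv_of_mul_eq_one_right h1
      rw [map_inv, eq_inv_mul_iff_mul_eq, this]
    rw [h4, map_inv] at h2
    show m * σ m = σ m * m
    have h5 : m * (σ m)⁻¹ = (σ m)⁻¹ * m := by
      rw [← mul_inv_eq_one]
      rw [← h2]; group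
    calc m * σ m = σ m * ((σ m)⁻¹ * m) * σ m := by group
      _ = σ m * m := by rw [← h5]; group
  have hc1 : ∀ g m, Commute m (g * σ m * g⁻¹) := by
    intro g m
    obtain ⟨a, rfl⟩ := fpf_surj σ hf g
    have := hc (a * m * a⁻¹)
    have h2 := Commute.conj this a⁻¹
    simpa [mul_assoc] using h2
  have hc2 : ∀ g m, Commute m (g * σ (σ m) * g⁻¹) := by
    intro g m
    have h1 := hc1 (σ g)⁻¹ m
    have h2 : Commute (σ g * m * (σ g)⁻¹) (σ m) := by
      have := Commute.conj h1 (σ g)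
      simpa [mul_assoc] using this
    have h3' := h2.symm.map (σ.comp σ)
    simpa [h3, mul_assoc] using h3'
  apply solv_comm_conj
  intro a g
  have h1 := hn (g * a * g⁻¹)
  have h2 : g * a * g⁻¹ = (σ (g * a * g⁻¹) * σ (σ (g * a * g⁻¹)))⁻¹ := by
    rw [mul_assoc] at h1
    exact eq_inv_of_mul_eq_one_left h1
  rw [h2]
  apply Commute.inv_right
  apply Commute.mul_right
  · simpa using hc1 (σ g) a
  · simpa using hc2 (σ (σ g)) a

/-- A finite group with a self-centralizing subgroup of order two is solvable. -/
theorem selfcent2 {G : Type*} [Group G] [Finite G] (t : G) (ht : t * t = 1) (ht1 : t ≠ 1)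
    (hC : ∀ g, g * t = t * g → g = 1 ∨ g = t) : Group.IsSolvable G := by
  have : Fact (Nat.Prime 2) := ⟨Nat.prime_two⟩
  have hti : t⁻¹ = t := inv_eq_of_mul_eq_one_left ht
  have ho : orderOf t = 2 := orderOf_eq_prime (by rw [pow_two, ht]) ht1
  have hz : ∀ g ∈ zpowers t, g = 1 ∨ g = t := by
    intro g hg
    obtain ⟨k, rfl⟩ := mem_zpowers_iff.1 hg
    exact hC _ ((Commute.refl t).zpow_left k)
  obtain ⟨K, hK, hd, hs⟩ := burnside_compl 2 t ho
    (by
      intro g hg _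
      rcases hC g hg with rfl | rfl
      · exact one_mem _
      · exact mem_zpowers _)
    (by
      intro g hg
      rcases hz _ hg with h | h
      · exact absurd (by simpa using h) ht1
      · rwa [mul_inv_eq_iff_eq_mul] at h)
  have hsK : Group.IsSolvable K := by
    refine fpf2 ({ toFun := fun k => ⟨t * k * t⁻¹, hK.conj_mem k k.2 t⟩, map_one' := by simp
                   map_mul' := fun a b => Subtype.ext (by simp) } : K →* K) ?_ ?_
    · intro m
      apply Subtype.ext
      show t * (t * m * t⁻¹) * t⁻¹ = m
      rw [hti]
      calc t * (t * m * t) * t = (t * t) * m * (t * t) := by group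
        _ = m := by rw [ht]; simp
    · intro m hm
      have hm' : t * m * t⁻¹ = m := congrArg Subtype.val hm
      rw [mul_inv_eq_iff_eq_mul] at hm'
      rcases hC m hm'.symm with h | h
      · exact Subtype.ext h
      · have : (m : G) = 1 := (Subgroup.disjoint_def.1 hd) m.2 (h ▸ mem_zpowers t)
        exact Subtype.ext this
  apply solv_top
  rw [← hs, sup_comm]
  exact solv_sup _ _ hsK (solv_zpowers t) (by rw [normalizer_eq_top]; exact le_top)

theorem eq_one_of_sq_cube {G : Type*} [Group G] {w : G} (h2 : w * w = 1) (h3 : w ^ 3 = 1) :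
    w = 1 := by
  rwa [pow_succ, pow_two, h2, one_mul] at h3

theorem zpowers_normal_of_central {G : Type*} [Group G] {z : G} (hz : ∀ g, g * z = z * g) :
    (zpowers z).Normal := by
  constructor
  intro n hn g
  obtain ⟨k, rfl⟩ := mem_zpowers_iff.1 hn
  have : g * z ^ k = z ^ k * g := Commute.zpow_right (hz g) k
  rw [this, mul_inv_cancel_right]
  exact hn

theorem selfcent2_central {G : Type*} [Group G] [Finite G] (t z : G) (hz : ∀ g, g * z = z * g)
    (hz3 : z ^ 3 = 1) (ht : t * t = 1) (ht1 : t ≠ 1)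
    (hC : ∀ g, g * t = t * g → g ∈ zpowers z ∨ g * t ∈ zpowers z) : Group.IsSolvable G := by
  have := zpowers_normal_of_central hz
  have hcube : ∀ w ∈ zpowers z, w ^ 3 = 1 := by
    intro w hw
    obtain ⟨k, rfl⟩ := mem_zpowers_iff.1 hw
    rw [← zpow_natCast, ← zpow_mul, mul_comm, zpow_mul, zpow_natCast, hz3, one_zpow]
  have hcomm : ∀ w ∈ zpowers z, ∀ g, g * w = w * g := by
    intro w hw g
    obtain ⟨k, rfl⟩ := mem_zpowers_iff.1 hw
    exact Commute.zpow_right (hz g) k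
  rw [Group.isSolvable_iff_subgroup_quotient (zpowers z)]
  refine ⟨solv_zpowers z, ?_⟩
  apply selfcent2 (t : G ⧸ zpowers z)
  · rw [← QuotientGroup.mk_mul, ht]; rfl
  · intro h
    rw [QuotientGroup.eq_one_iff] at h
    exact ht1 (eq_one_of_sq_cube ht (hcube t h))
  · intro q hq
    induction q using QuotientGroup.induction_on with
    | H g =>
      rw [← QuotientGroup.mk_mul, ← QuotientGroup.mk_mul, eq_comm, QuotientGroup.eq] at hq
      set w := (t * g)⁻¹ * (g * t) with hw
      have e : g * t = t * g * w := by rw [hw]; group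
      have e1 : g * t * g⁻¹ = t * w := by
        rw [e, mul_assoc t g w, hcomm w hq g]; group
      have e2 : w * w = 1 := by
        have : (g * t * g⁻¹) * (g * t * g⁻¹) = 1 := by
          calc (g * t * g⁻¹) * (g * t * g⁻¹) = g * (t * t) * g⁻¹ := by group
            _ = 1 := by rw [ht]; group
        rw [e1] at this
        calc w * w = (t * t) * w * w := by rw [ht, one_mul]
          _ = t * (t * w) * w := by group
          _ = t * (w * t) * w := by rw [← hcomm w hq t]
          _ = t * w * (t * w) := by group
          _ = 1 := this
      have e3 := eq_one_of_sq_cube e2 (hcube w hq)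
      rw [e3, mul_one] at e
      rcases hC g e with h | h
      · left; rwa [QuotientGroup.eq_one_iff]
      · right
        rw [eq_comm, QuotientGroup.eq]
        have : t⁻¹ = t := inv_eq_of_mul_eq_one_left ht
        rw [this, ← e]; exact h

theorem fpf3_central {M : Type*} [Group M] [Finite M] (σ : M →* M) (h3 : ∀ m, σ (σ (σ m)) = m)
    (z : M) (hz : ∀ g, g * z = z * g) (hz2 : z * z = 1) (hσz : σ z = z)
    (hf : ∀ m, σ m = m → m ∈ zpowers z) : Group.IsSolvable M := by
  have := zpowers_normal_of_central hz
  have hsq : ∀ w ∈ zpowers z, w * w = 1 := by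
    intro w hw
    obtain ⟨k, rfl⟩ := mem_zpowers_iff.1 hw
    rw [← zpow_add, ← two_mul, zpow_mul, zpow_two, hz2, one_zpow]
  have hfix : ∀ w ∈ zpowers z, σ w = w := by
    intro w hw
    obtain ⟨k, rfl⟩ := mem_zpowers_iff.1 hw
    rw [map_zpow, hσz]
  rw [Group.isSolvable_iff_subgroup_quotient (zpowers z)]
  refine ⟨solv_zpowers z, ?_⟩
  apply fpf3 (QuotientGroup.map (zpowers z) (zpowers z) σ
    (fun w hw => by rw [mem_comap, hfix w hw]; exact hw))
  · intro q
    induction q using QuotientGroup.induction_on with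
    | H g => simp [h3]
  · intro q hq
    induction q using QuotientGroup.induction_on with
    | H g =>
      rw [QuotientGroup.map_mk, eq_comm, QuotientGroup.eq] at hq
      set w := g⁻¹ * σ g with hw
      have e : σ g = g * w := by rw [hw]; group
      have e3 : w ^ 3 = 1 := by
        have := h3 g
        rw [e, map_mul, e, hfix w hq, map_mul, map_mul, e, hfix w hq] at this
        have h : g * w ^ 3 = g := by
          rw [pow_succ, pow_two]; simpa [mul_assoc] using this
        exact mul_eq_left.1 h
      have e1 := eq_one_of_sq_cube (hsq w hq) e3
      rw [e1, mul_one] at e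
      rw [QuotientGroup.eq_one_iff]
      exact hf g e

theorem case6 {G : Type*} [Group G] [Finite G] (x : G) (hx : orderOf x = 6)
    (hS : ∀ y ∈ Sol x, y ∈ zpowers x) : Group.IsSolvable G := by
  have hx6 : x ^ 6 = 1 := hx ▸ pow_orderOf_eq_one x
  have hne : ∀ n, 0 < n → n < 6 → x ^ n ≠ 1 := by
    intro n h0 h6
    exact pow_ne_one_of_lt_orderOf h0.ne' (hx ▸ h6)
  have hCx : ∀ g, g * x = x * g → g ∈ zpowers x := fun g hg => hS g (mem_Sol_of_comm hg)
  have hel : ∀ y ∈ zpowers x, y = 1 ∨ y = x ∨ y = x ^ 2 ∨ y = x ^ 3 ∨ y = x ^ 4 ∨ y = x ^ 5 := by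
    intro y hy
    have hy' : y ∈ Submonoid.powers x := mem_powers_iff_mem_zpowers.2 hy
    obtain ⟨j, rfl⟩ := hy'
    have hj : x ^ j = x ^ (j % 6) := by rw [← hx, pow_mod_orderOf]
    show x ^ j = _ ∨ x ^ j = _ ∨ x ^ j = _ ∨ x ^ j = _ ∨ x ^ j = _ ∨ x ^ j = _
    rw [hj]
    have hi : j % 6 < 6 := Nat.mod_lt _ (by norm_num)
    generalize j % 6 = i at hi
    interval_cases i <;> simp
  have hu3 : (x ^ 2) ^ 3 = 1 := by rw [← pow_mul]; exact hx6
  have ht2 : (x ^ 3) * (x ^ 3) = 1 := by rw [← pow_add]; exact hx6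
  -- commuting with both `x ^ 2` and `x ^ 3`
  have hboth : ∀ g, g * x ^ 2 = x ^ 2 * g → g * x ^ 3 = x ^ 3 * g → g ∈ zpowers x := by
    intro g h2 h3
    apply hCx
    have h : Commute g ((x ^ 2)⁻¹ * x ^ 3) :=
      (Commute.inv_right (show Commute g (x ^ 2) from h2)).mul_right h3
    have e : (x ^ 2)⁻¹ * x ^ 3 = x := by group
    rw [e] at h
    exact h
  -- the centralizer of `x ^ 2`
  have hCu : ∀ g, g * x ^ 2 = x ^ 2 * g → g ∈ zpowers x := by
    have hsol : Group.IsSolvable (centralizer ({x ^ 2} : Set G)) := by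
      have m2 : x ^ 2 ∈ centralizer ({x ^ 2} : Set G) := by rw [mem_centralizer_singleton_iff]
      have m3 : x ^ 3 ∈ centralizer ({x ^ 2} : Set G) := by
        rw [mem_centralizer_singleton_iff, ← pow_add, ← pow_add]
      apply selfcent2_central (⟨x ^ 3, m3⟩ : centralizer ({x ^ 2} : Set G)) ⟨x ^ 2, m2⟩
      · intro g
        exact Subtype.ext (mem_centralizer_singleton_iff.1 g.2)
      · exact Subtype.ext hu3
      · exact Subtype.ext ht2
      · intro h
        exact hne 3 (by norm_num) (by norm_num) (congrArg Subtype.val h)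
      · intro g hg
        have hg' : (g : G) * x ^ 3 = x ^ 3 * g := congrArg Subtype.val hg
        have hm := hboth g (mem_centralizer_singleton_iff.1 g.2) hg'
        rcases hel _ hm with h | h | h | h | h | h
        · left; rw [mem_zpowers_iff]; exact ⟨0, Subtype.ext (by simp [h])⟩
        · right; rw [mem_zpowers_iff]; refine ⟨2, Subtype.ext ?_⟩
          simp only [coe_mul, h, coe_zpow]; group
        · left; rw [mem_zpowers_iff]; refine ⟨1, Subtype.ext ?_⟩
          simp [h]
        · right; rw [mem_zpowers_iff]; refine ⟨0, Subtype.ext ?_⟩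
          simp [h, ht2]
        · left; rw [mem_zpowers_iff]; refine ⟨2, Subtype.ext ?_⟩
          simp only [h, coe_zpow]; group
        · right; rw [mem_zpowers_iff]; refine ⟨1, Subtype.ext ?_⟩
          simp only [coe_mul, h, coe_zpow]
          rw [← pow_add, show 5 + 3 = 6 + 2 from rfl, pow_add, hx6]; simp
    intro g hg
    refine hS g (mem_Sol_of_le hsol ?_ (mem_centralizer_singleton_iff.2 hg))
    rw [mem_centralizer_singleton_iff, ← pow_succ, ← pow_succ']
  have hNu : ∀ g, g * x ^ 2 * g⁻¹ ∈ zpowers (x ^ 2) → g * x ^ 2 = x ^ 2 * g := by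
    intro g hg
    have h1 : g * x * g⁻¹ ∈ zpowers x := by
      apply hCu
      -- `g * x * g⁻¹` commutes with the conjugates of powers of `x ^ 2`
      have hn := zpowers_le_norm hg (mem_zpowers g)
      have h2 : g⁻¹ * x ^ 2 * g ∈ zpowers (x ^ 2) := by
        have := (Subgroup.mem_normalizer_iff''.1 hn (x ^ 2)).1 (mem_zpowers _)
        exact this
      obtain ⟨k, hk⟩ := mem_zpowers_iff.1 h2
      have h3 : Commute x (g⁻¹ * x ^ 2 * g) := by
        rw [← hk]
        exact ((Commute.refl x).pow_right 2).zpow_right k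
      have h4 := Commute.conj h3 g
      have e : g * (g⁻¹ * x ^ 2 * g) * g⁻¹ = x ^ 2 := by group
      rw [e] at h4
      exact h4
    have h2 := hS g (mem_Sol_of_norm h1)
    obtain ⟨k, rfl⟩ := mem_zpowers_iff.1 h2
    exact ((Commute.refl x).zpow_left k).pow_right 2
  have ho : orderOf (x ^ 2) = 3 :=
    have : Fact (Nat.Prime 3) := ⟨Nat.prime_three⟩
    orderOf_eq_prime hu3 (hne 2 (by norm_num) (by norm_num))
  have : Fact (Nat.Prime 3) := ⟨Nat.prime_three⟩
  obtain ⟨K, hK, hd, hs⟩ := burnside_compl 3 (x ^ 2) ho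
    (by
      rintro g hg ⟨n, hn⟩
      have hodd : ∀ m : ℕ, (x ^ 3) ^ 3 ^ m = x ^ 3 := by
        intro m
        obtain ⟨j, hj⟩ : Odd (3 ^ m) := Odd.pow (by decide)
        rw [hj, pow_succ, pow_mul, pow_two, ht2, one_pow, one_mul]
      have key : ∀ i : ℕ, (x ^ i) ^ 3 ^ n = 1 → (x ^ i) ^ 3 = 1 := by
        intro i hi
        have h1 : (x ^ 3) ^ i = 1 := by
          rw [← hodd n, ← pow_mul, ← pow_mul, show 3 * (3 ^ n * i) = i * 3 ^ n * 3 by ring,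
            pow_mul, pow_mul x i, hi, one_pow]
        rw [← pow_mul, mul_comm, pow_mul, h1]
      rcases hel g (hCu g hg) with h | h | h | h | h | h
      · rw [h]; exact one_mem _
      · have := key 1 (by rw [pow_one, ← h]; exact hn)
        rw [← pow_mul] at this
        exact absurd this (hne 3 (by norm_num) (by norm_num))
      · rw [h]; exact mem_zpowers _
      · have := key 3 (by rw [← h]; exact hn)
        rw [pow_succ, pow_two, ht2, one_mul] at this
        exact absurd this (hne 3 (by norm_num) (by norm_num))
      · rw [h, show (4 : ℕ) = 2 * 2 from rfl, pow_mul]; exact pow_mem (mem_zpowers _) 2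
      · have := key 5 (by rw [← h]; exact hn)
        rw [← pow_mul, show 5 * 3 = 6 + 6 + 3 from rfl, pow_add, pow_add, hx6] at this
        simp only [one_mul] at this
        exact absurd this (hne 3 (by norm_num) (by norm_num)))
    hNu
  have hKA : ∀ g ∈ K, g ∈ zpowers x → g = 1 ∨ g = x ^ 3 := by
    intro g hgK hg
    have hsq : g * g = 1 := by
      apply Subgroup.disjoint_def.1 hd (mul_mem hgK hgK)
      obtain ⟨k, rfl⟩ := mem_zpowers_iff.1 hg
      rw [mem_zpowers_iff]
      exact ⟨k, by group⟩
    rcases hel g hg with h | h | h | h | h | h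
    · exact Or.inl h
    · rw [h, ← pow_two] at hsq
      exact absurd hsq (hne 2 (by norm_num) (by norm_num))
    · rw [h, ← pow_add] at hsq
      exact absurd hsq (hne 4 (by norm_num) (by norm_num))
    · exact Or.inr h
    · rw [h, ← pow_add, show 4 + 4 = 6 + 2 from rfl, pow_add, hx6, one_mul] at hsq
      exact absurd hsq (hne 2 (by norm_num) (by norm_num))
    · rw [h, ← pow_add, show 5 + 5 = 6 + 4 from rfl, pow_add, hx6, one_mul] at hsq
      exact absurd hsq (hne 4 (by norm_num) (by norm_num))
  have htK : x ^ 3 ∈ K := by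
    have hm : x ^ 3 ∈ K ⊔ zpowers (x ^ 2) := by rw [hs]; trivial
    rw [Subgroup.mem_sup_of_normal_left] at hm
    obtain ⟨k, hk, w, hw, e⟩ := hm
    obtain ⟨j, rfl⟩ := mem_zpowers_iff.1 hw
    have hkx : k ∈ zpowers x := by
      rw [eq_mul_inv_of_mul_eq e]
      exact mul_mem (pow_mem (mem_zpowers x) 3) (inv_mem (zpow_mem (pow_mem (mem_zpowers x) 2) j))
    rcases hKA k hk hkx with h | h
    · exfalso
      rw [h, one_mul] at e
      have h1 : (x ^ 3) ^ 3 = 1 := by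
        rw [← e, ← zpow_natCast, ← zpow_mul, mul_comm, zpow_mul, zpow_natCast, hu3, one_zpow]
      exact hne 3 (by norm_num) (by norm_num) (eq_one_of_sq_cube ht2 h1)
    · exact h ▸ hk
  -- the centralizer of `x ^ 3` in `K`
  have hKt : ∀ g ∈ K, g * x ^ 3 = x ^ 3 * g → g = 1 ∨ g = x ^ 3 := by
    have hxt : x ∈ centralizer ({x ^ 3} : Set G) := by
      rw [mem_centralizer_singleton_iff, ← pow_succ, ← pow_succ']
    have hnorm : ∀ g ∈ centralizer ({x ^ 3} : Set G),
        ∀ m ∈ K ⊓ centralizer ({x ^ 3} : Set G),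
        g * m * g⁻¹ ∈ K ⊓ centralizer ({x ^ 3} : Set G) := by
      intro g hg m hm
      exact ⟨hK.conj_mem m hm.1 g, Subgroup.mul_mem _ (Subgroup.mul_mem _ hg hm.2) (Subgroup.inv_mem _ hg)⟩
    have hsol : Group.IsSolvable ↥(K ⊓ centralizer ({x ^ 3} : Set G)) := by
      have m3 : x ^ 3 ∈ K ⊓ centralizer ({x ^ 3} : Set G) := ⟨htK, pow_mem hxt 3⟩
      refine fpf3_central
        ({ toFun := fun m => ⟨x ^ 2 * m * (x ^ 2)⁻¹, hnorm _ (pow_mem hxt 2) m m.2⟩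
           map_one' := by simp
           map_mul' := fun a b => Subtype.ext (by simp) } :
          ↥(K ⊓ centralizer ({x ^ 3} : Set G)) →* ↥(K ⊓ centralizer ({x ^ 3} : Set G)))
        ?_ ⟨x ^ 3, m3⟩ ?_ ?_ ?_ ?_
      · intro m
        apply Subtype.ext
        show x ^ 2 * (x ^ 2 * (x ^ 2 * m * (x ^ 2)⁻¹) * (x ^ 2)⁻¹) * (x ^ 2)⁻¹ = m
        calc _ = x ^ 6 * m * (x ^ 6)⁻¹ := by group
          _ = m := by rw [hx6]; simp
      · intro g
        exact Subtype.ext (mem_centralizer_singleton_iff.1 g.2.2)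
      · exact Subtype.ext ht2
      · apply Subtype.ext
        show x ^ 2 * x ^ 3 * (x ^ 2)⁻¹ = x ^ 3
        group
      · intro m hm
        have hm' : x ^ 2 * m * (x ^ 2)⁻¹ = m := congrArg Subtype.val hm
        rw [mul_inv_eq_iff_eq_mul] at hm'
        have h1 := hCu m hm'.symm
        rcases hKA m m.2.1 h1 with h | h
        · rw [mem_zpowers_iff]; exact ⟨0, Subtype.ext (by simp [h])⟩
        · rw [mem_zpowers_iff]; exact ⟨1, Subtype.ext (by simp [h])⟩
    intro g hg hgt
    apply hKA g hg
    apply hS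
    refine mem_Sol_of_le (solv_sup _ (zpowers x) hsol (solv_zpowers x) ?_)
      (le_sup_left (a := zpowers x) (mem_zpowers x))
      (le_sup_right (a := zpowers x) ⟨hg, mem_centralizer_singleton_iff.2 hgt⟩)
    rw [zpowers_le]
    exact Subgroup.mem_normalizer_fintype (fun m hm => hnorm x hxt m hm)
  have hsK : Group.IsSolvable K := by
    apply selfcent2 (⟨x ^ 3, htK⟩ : K)
    · exact Subtype.ext ht2
    · intro h
      exact hne 3 (by norm_num) (by norm_num) (congrArg Subtype.val h)
    · intro g hg
      rcases hKt g g.2 (congrArg Subtype.val hg) with h | h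
      · left; exact Subtype.ext h
      · right; exact Subtype.ext h
  apply solv_top
  rw [← hs, sup_comm]
  exact solv_sup _ _ hsK (solv_zpowers _) (by rw [normalizer_eq_top]; exact le_top)

/-- The integrality of the trace of a real element of order three. -/
theorem trace_int {d : ℕ} (X : Matrix (Fin d) (Fin d) ℂ) (h3 : X * X * X = 1)
    (ht : (X * X).trace = X.trace) : ∃ n : ℤ, X.trace = n := by
  obtain ⟨ω, hω⟩ : ∃ ω : ℂ, 1 + ω + ω ^ 2 = 0 := by
    obtain ⟨z, hz⟩ := IsAlgClosed.exists_root
      (Polynomial.X ^ 2 + Polynomial.X + Polynomial.C (1 : ℂ)) (by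
        have : (Polynomial.X ^ 2 + Polynomial.X + Polynomial.C (1 : ℂ)).degree = 2 := by
          compute_degree!
        rw [this]; norm_num)
    refine ⟨z, ?_⟩
    simp only [Polynomial.IsRoot, Polynomial.eval_add, Polynomial.eval_pow, Polynomial.eval_X,
      Polynomial.eval_C] at hz
    rw [← hz]; ring
  have hω3 : ω ^ 3 = 1 := by linear_combination (ω - 1) * hω
  have hω2 : ω ^ 2 = -1 - ω := by linear_combination hω
  set f : Matrix (Fin d) (Fin d) ℂ := (1 / 3 : ℂ) • (1 + ω • X + ω ^ 2 • (X * X)) with hf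
  have hid : f * f = f := by
    have h4 : X * X * (X * X) = X := by
      rw [← mul_assoc, h3, one_mul]
    have h3' : X * (X * X) = 1 := by rw [← mul_assoc, h3]
    rw [hf]
    simp only [smul_mul_smul_comm, mul_add, add_mul, one_mul, mul_one, Matrix.smul_mul,
      Matrix.mul_smul, smul_add, smul_smul, h4, h3, h3']
    have e1 : ω * ω ^ 2 = 1 := by rw [← hω3]; ring
    have e2 : ω ^ 2 * ω = 1 := by rw [← hω3]; ring
    have e3 : ω ^ 2 * ω ^ 2 = ω := by linear_combination ω * hω3
    have e4 : ω * ω = ω ^ 2 := by ring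
    match_scalars
    · linear_combination (2 / 9 : ℂ) * hω3
    · linear_combination (1 / 9 : ℂ) * ω * hω3
    · ring
  have htr : ∃ s : ℕ, f.trace = s := by
    have hidl : IsIdempotentElem (Matrix.toLin' f) := by
      show Matrix.toLin' f * Matrix.toLin' f = Matrix.toLin' f
      rw [Module.End.mul_eq_comp, ← Matrix.toLin'_mul, hid]
    refine ⟨Module.finrank ℂ (LinearMap.range (Matrix.toLin' f)), ?_⟩
    rw [← Matrix.trace_toLin'_eq]
    exact (LinearMap.IsIdempotentElem.isProj_range _ hidl).trace
  obtain ⟨s, hs⟩ := htr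
  refine ⟨d - 3 * s, ?_⟩
  have : f.trace = (1 / 3 : ℂ) * (d - X.trace) := by
    rw [hf]
    simp only [Matrix.trace_smul, Matrix.trace_add, Matrix.trace_one, Fintype.card_fin, ht,
      smul_eq_mul]
    rw [hω2]; ring
  rw [hs] at this
  push_cast
  linear_combination 3 * this

/-- The trace of left multiplication on a product of matrix algebras. -/
theorem trace_mulLeft_pi {N : ℕ} (d : Fin N → ℕ) (a : Π i, Matrix (Fin (d i)) (Fin (d i)) ℂ) :
    LinearMap.trace ℂ (Π i, Matrix (Fin (d i)) (Fin (d i)) ℂ) (LinearMap.mulLeft ℂ a) =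
      ∑ i, (d i : ℂ) * (a i).trace := by
  classical
  rw [LinearMap.trace_eq_matrix_trace ℂ
    (Pi.basis (fun i => Matrix.stdBasis ℂ (Fin (d i)) (Fin (d i))))]
  simp only [Matrix.trace, Matrix.diag_apply, LinearMap.toMatrix_apply]
  rw [Fintype.sum_sigma]
  refine Finset.sum_congr rfl fun i _ => ?_
  rw [Fintype.sum_prod_type, Finset.mul_sum]
  refine Finset.sum_congr rfl fun j _ => ?_
  have key : ∀ M : Matrix (Fin (d i)) (Fin (d i)) ℂ, ∀ k l,
      (Matrix.stdBasis ℂ (Fin (d i)) (Fin (d i))).repr M (k, l) = M k l := by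
    intro M k l
    simp [Matrix.stdBasis]
  simp [key, Matrix.stdBasis_eq_single]

/-- The trace of the regular representation. -/
theorem trace_mulLeft_single {G : Type*} [Group G] [Fintype G] [DecidableEq G] (g : G) :
    LinearMap.trace ℂ (MonoidAlgebra ℂ G) (LinearMap.mulLeft ℂ (MonoidAlgebra.single g 1)) =
      if g = 1 then (Fintype.card G : ℂ) else 0 := by
  rw [LinearMap.trace_eq_matrix_trace ℂ (MonoidAlgebra.basis G ℂ)]
  simp only [Matrix.trace, Matrix.diag_apply, LinearMap.toMatrix_apply]
  have : ∀ h : G, ((MonoidAlgebra.basis G ℂ).repr ((LinearMap.mulLeft ℂ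
      (MonoidAlgebra.single g (1 : ℂ))) ((MonoidAlgebra.basis G ℂ) h))) h
      = if g = 1 then 1 else 0 := by
    intro h
    simp [MonoidAlgebra.single_mul_single, MonoidAlgebra.basis, Finsupp.single_apply]
  rw [Finset.sum_congr rfl (fun h _ => this h)]
  split_ifs <;> simp

theorem arith_lemma {N : ℕ} (d : Fin N → ℕ) (n : Fin N → ℤ) (hd : ∀ i, 0 < d i) (i0 : Fin N)
    (hd0 : d i0 = 1) (hn0 : n i0 = 1) (h2 : ∑ i, n i ^ 2 = 3) (h1 : ∑ i, (d i : ℤ) * n i = 0) :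
    (1 : ℝ) ≤ ∑ i, (n i : ℝ) ^ 3 / d i := by
  classical
  rw [← Finset.add_sum_erase _ _ (Finset.mem_univ i0)] at h1 h2 ⊢
  rw [hn0, hd0] at *
  set s := Finset.univ.erase i0
  have h2' : ∑ i ∈ s, n i ^ 2 = 2 := by linarith
  have h1' : ∑ i ∈ s, (d i : ℤ) * n i = -1 := by push_cast at h1; linarith
  suffices (0 : ℝ) ≤ ∑ i ∈ s, (n i : ℝ) ^ 3 / d i by
    norm_num; exact this
  have hle : ∀ i ∈ s, n i ^ 2 ≤ 2 := fun i hi =>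
    h2' ▸ Finset.single_le_sum (f := fun i => n i ^ 2) (fun j _ => sq_nonneg (n j)) hi
  have hval : ∀ i ∈ s, n i = 0 ∨ n i = 1 ∨ n i = -1 := by
    intro i hi
    have := hle i hi
    have h3 : n i < 2 := by nlinarith
    have h4 : -2 < n i := by nlinarith
    omega
  set T := s.filter (fun i => n i ≠ 0)
  have hT : T.card = 2 := by
    have : ∑ i ∈ s, n i ^ 2 = T.card := by
      rw [Finset.card_filter]
      push_cast
      refine Finset.sum_congr rfl fun i hi => ?_
      rcases hval i hi with h | h | h <;> simp [h]
    exact_mod_cast this.symm.trans h2'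
  have hsumT : ∀ (f : Fin N → ℝ), (∀ i, n i = 0 → f i = 0) → ∑ i ∈ s, f i = ∑ i ∈ T, f i := by
    intro f hf
    symm
    apply Finset.sum_filter_of_ne
    intro i _ hi h0
    exact hi (hf i h0)
  rw [hsumT _ (by intro i hi; simp [hi])]
  have h1'' : ∑ i ∈ T, (d i : ℝ) * n i = -1 := by
    rw [← hsumT _ (by intro i hi; simp [hi])]
    exact_mod_cast h1'
  obtain ⟨p, q, hpq, hTe⟩ := Finset.card_eq_two.1 hT
  have hp : p ∈ T := by rw [hTe]; simp
  have hq : q ∈ T := by rw [hTe]; simp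
  have hp' := (Finset.mem_filter.1 hp)
  have hq' := (Finset.mem_filter.1 hq)
  rw [hTe, Finset.sum_pair hpq] at h1'' ⊢
  have dp : (1 : ℝ) ≤ d p := by exact_mod_cast hd p
  have dq : (1 : ℝ) ≤ d q := by exact_mod_cast hd q
  rcases hval p hp'.1 with h | h | h
  · exact absurd h hp'.2
  · rcases hval q hq'.1 with h' | h' | h'
    · exact absurd h' hq'.2
    · rw [h, h'] at h1''; push_cast at h1''; linarith
    · rw [h, h'] at h1'' ⊢; push_cast at h1'' ⊢
      have : (1 : ℝ) / d q ≤ 1 / d p := one_div_le_one_div_of_le (by linarith) (by linarith)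
      have e : (-1 : ℝ) ^ 3 / d q = - (1 / d q) := by ring
      rw [e, one_pow]; linarith
  · rcases hval q hq'.1 with h' | h' | h'
    · exact absurd h' hq'.2
    · rw [h, h'] at h1'' ⊢; push_cast at h1'' ⊢
      have : (1 : ℝ) / d p ≤ 1 / d q := one_div_le_one_div_of_le (by linarith) (by linarith)
      have e : (-1 : ℝ) ^ 3 / d p = - (1 / d p) := by ring
      rw [e, one_pow]; linarith
    · rw [h, h'] at h1''; push_cast at h1''; linarith


/-- The absolutely irreducible representations, packaged as matrix-valued functions. -/
theorem exists_irreps (G : Type*) [Group G] [Fintype G] [DecidableEq G] :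
    ∃ (N : ℕ) (d : Fin N → ℕ) (ρ : ∀ i, G → Matrix (Fin (d i)) (Fin (d i)) ℂ),
      (∀ i, 0 < d i) ∧ (∀ i g h, ρ i (g * h) = ρ i g * ρ i h) ∧ (∀ i, ρ i 1 = 1) ∧
      (∀ g, ∑ i, (d i : ℂ) * (ρ i g).trace = if g = 1 then (Fintype.card G : ℂ) else 0) ∧
      (∀ i (M : Matrix (Fin (d i)) (Fin (d i)) ℂ), (∀ g, M * ρ i g = ρ i g * M) →
        ∃ c : ℂ, M = c • 1) := by
  obtain ⟨N, d, hd, ⟨φ⟩⟩ :=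
    IsSemisimpleRing.exists_algEquiv_pi_matrix_of_isAlgClosed ℂ (MonoidAlgebra ℂ G)
  refine ⟨N, d, fun i g => φ (MonoidAlgebra.single g 1) i, fun i => Nat.pos_of_ne_zero (hd i).out,
    ?_, ?_, ?_, ?_⟩
  · intro i g h
    rw [← Pi.mul_apply, ← map_mul, MonoidAlgebra.single_mul_single, one_mul]
  · intro i
    show φ (MonoidAlgebra.single 1 1) i = 1
    rw [← MonoidAlgebra.one_def, map_one, Pi.one_apply]
  · intro g
    rw [← trace_mulLeft_single, ← trace_mulLeft_pi,
      ← LinearMap.trace_conj' _ φ.toLinearEquiv]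
    congr 1
    refine LinearMap.ext fun y => ?_
    simp only [LinearEquiv.conj_apply, LinearMap.comp_apply, LinearMap.mulLeft_apply]
    show (fun i => φ (MonoidAlgebra.single g 1) i) * y
      = φ (MonoidAlgebra.single g 1 * φ.symm y)
    rw [map_mul, AlgEquiv.apply_symm_apply]
  · intro i M hM
    have h1 : ∀ a : MonoidAlgebra ℂ G, M * φ a i = φ a i * M := by
      intro a
      induction a using MonoidAlgebra.induction_on with
      | of g => exact hM g
      | add f g hf hg => rw [map_add, Pi.add_apply, mul_add, add_mul, hf, hg]
      | smul r f hf => rw [map_smul, Pi.smul_apply, Matrix.mul_smul, Matrix.smul_mul, hf]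
    have h2 : ∀ X : Matrix (Fin (d i)) (Fin (d i)) ℂ, M * X = X * M := by
      intro X
      have := h1 (φ.symm (Pi.single i X))
      rwa [AlgEquiv.apply_symm_apply, Pi.single_eq_same] at this
    have h3 : M ∈ Set.range (Matrix.scalar (Fin (d i))) := by
      rw [Matrix.mem_range_scalar_iff_commute_single]
      intro j k _
      exact (h2 _).symm
    obtain ⟨c, rfl⟩ := h3
    exact ⟨c, by rw [Matrix.smul_one_eq_diagonal]; rfl⟩

theorem char_lemma {G : Type*} [Group G] [Fintype G] (x : G) (hx3 : x ^ 3 = 1) (hx1 : x ≠ 1)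
    (hinv : ∃ t : G, t * x * t⁻¹ = x⁻¹)
    (hC : ∀ g : G, g * x = x * g → g = 1 ∨ g = x ∨ g = x⁻¹)
    (hN : ∀ b g h : G, b = g * x * g⁻¹ → x * b = h * x * h⁻¹ → b = x) :
    Fintype.card G ≤ 9 := by
  classical
  obtain ⟨N, d, ρ, hd, hmul, hone, hτ, hSchur⟩ := exists_irreps G
  set c : ℂ := (Fintype.card G : ℂ) with hc
  have hc0 : c ≠ 0 := by rw [hc]; exact_mod_cast Fintype.card_ne_zero
  have hd0 : ∀ i, (d i : ℂ) ≠ 0 := fun i => by exact_mod_cast (hd i).ne'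
  have hxx : x * x = x⁻¹ := by
    rw [eq_inv_iff_mul_eq_one, ← pow_two, ← pow_succ, hx3]
  have htc : ∀ i g a, (ρ i (g * a * g⁻¹)).trace = (ρ i a).trace := by
    intro i g a
    rw [hmul, Matrix.trace_mul_comm, ← hmul, inv_mul_cancel_left]
  have hntz : ∀ i, ∃ n : ℤ, (ρ i x).trace = n := by
    intro i
    apply trace_int
    · rw [← hmul, ← hmul, ← hone i, ← hx3, pow_succ, pow_two]
    · obtain ⟨t, ht⟩ := hinv
      rw [← hmul, hxx, ← ht, htc]
  choose n hn using hntz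
  have hΛ : ∀ i, ∃ l : ℂ, ∑ g : G, ρ i (g * x * g⁻¹) = l • 1 := by
    intro i
    apply hSchur
    intro h
    rw [Finset.sum_mul, Finset.mul_sum]
    rw [← Equiv.sum_comp (Equiv.mulLeft h)]
    refine Finset.sum_congr rfl fun g _ => ?_
    rw [← hmul, ← hmul]
    congr 1
    simp [mul_assoc]
  choose l hl using hΛ
  have hln : ∀ i, l i * d i = c * n i := by
    intro i
    have := congrArg Matrix.trace (hl i)
    rw [Matrix.trace_sum, Matrix.trace_smul, Matrix.trace_one, Fintype.card_fin] at this
    simp only [htc, hn, Finset.sum_const, Finset.card_univ, nsmul_eq_mul, smul_eq_mul] at this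
    exact this.symm
  have H1 : ∑ i, (d i : ℤ) * n i = 0 := by
    have := hτ x
    rw [if_neg hx1] at this
    simp only [hn] at this
    exact_mod_cast this
  have H2 : ∑ i, n i ^ 2 = 3 := by
    have e1 : ∑ i, (d i : ℂ) * ((∑ g : G, ρ i (g * x * g⁻¹)) * ρ i x).trace
        = c * ∑ i, (n i : ℂ) ^ 2 := by
      rw [Finset.mul_sum]
      refine Finset.sum_congr rfl fun i _ => ?_
      rw [hl, Matrix.smul_mul, one_mul, Matrix.trace_smul, hn, smul_eq_mul]
      linear_combination (n i : ℂ) * hln i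
    have e2 : ∑ i, (d i : ℂ) * ((∑ g : G, ρ i (g * x * g⁻¹)) * ρ i x).trace
        = c * 3 := by
      simp only [Finset.sum_mul, Matrix.trace_sum, Finset.mul_sum, ← hmul]
      rw [Finset.sum_comm]
      simp only [hτ]
      rw [← Finset.sum_filter, Finset.sum_const, nsmul_eq_mul, mul_comm]
      congr 1
      obtain ⟨t, ht⟩ := hinv
      have : Finset.univ.filter (fun g : G => g * x * g⁻¹ * x = 1) = {t, t * x, t * x⁻¹} := by
        ext g
        simp only [Finset.mem_filter, Finset.mem_univ, true_and, Finset.mem_insert,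
          Finset.mem_singleton, mul_eq_one_iff_eq_inv]
        constructor
        · intro hg
          rw [← ht] at hg
          have h4 : (t⁻¹ * g) * x = x * (t⁻¹ * g) := by
            have : t⁻¹ * (g * x * g⁻¹) * g = t⁻¹ * (t * x * t⁻¹) * g := by rw [hg]
            simpa [mul_assoc] using this
          rcases hC _ h4 with h | h | h
          · left; exact (inv_mul_eq_one.1 h).symm
          · right; left; exact inv_mul_eq_iff_eq_mul.1 h
          · right; right; exact inv_mul_eq_iff_eq_mul.1 h
        · rintro (rfl | rfl | rfl)
          · exact ht
          · rw [← ht]; group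
          · rw [show t * x⁻¹ * x * (t * x⁻¹)⁻¹ = t * x * t⁻¹ by group, ht]
      rw [this]
      have hxi : x ≠ x⁻¹ := by
        intro h
        rw [← hxx] at h
        exact hx1 (by simpa using h)
      rw [Finset.card_insert_of_notMem, Finset.card_pair]
      · norm_num
      · simpa using hxi
      · simp [hx1]
    have := mul_left_cancel₀ hc0 (e1.symm.trans e2)
    exact_mod_cast this
  -- the principal component
  have hE : ∀ i, ∃ m : ℂ, ∑ g : G, ρ i g = m • 1 := by
    intro i
    apply hSchur
    intro h
    rw [Finset.sum_mul, Finset.mul_sum]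
    simp only [← hmul]
    exact (Equiv.sum_comp (Equiv.mulRight h) (fun g => ρ i g)).trans
      (Equiv.sum_comp (Equiv.mulLeft h) (fun g => ρ i g)).symm
  choose m hm using hE
  have hEx : ∀ i h, m i • ρ i h = m i • 1 := by
    intro i h
    rw [← hm, ← Equiv.sum_comp (Equiv.mulRight h) (fun g => ρ i g)]
    simp only [Equiv.coe_mulRight, hmul]
    rw [← Finset.sum_mul, hm, Matrix.smul_mul, one_mul]
  have hEt : ∑ i, (d i : ℂ) * (m i * d i) = c := by
    have : ∑ i, (d i : ℂ) * (∑ g : G, ρ i g).trace = c := by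
      simp only [Matrix.trace_sum, Finset.mul_sum]
      rw [Finset.sum_comm]
      simp only [hτ]
      simp [hc]
    rw [← this]
    refine Finset.sum_congr rfl fun i _ => ?_
    rw [hm, Matrix.trace_smul, Matrix.trace_one, Fintype.card_fin, smul_eq_mul]
  have hm01 : ∀ i, m i ≠ 0 → (∀ h, ρ i h = 1) ∧ m i = c := by
    intro i hi
    have h1 : ∀ h, ρ i h = 1 := fun h => smul_right_injective _ hi (hEx i h)
    refine ⟨h1, ?_⟩
    have := congrArg Matrix.trace (hm i)
    rw [Matrix.trace_sum] at this
    simp only [h1, Finset.sum_const, Matrix.trace_smul, Matrix.trace_one, Fintype.card_fin,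
      Finset.card_univ, smul_eq_mul, nsmul_eq_mul] at this
    exact (mul_right_cancel₀ (hd0 i) this).symm
  obtain ⟨i0, hi0, hdi0⟩ : ∃ i, m i ≠ 0 ∧ d i = 1 := by
    have h1 : ∑ i, (if m i ≠ 0 then d i * d i else 0) = 1 := by
      have : c * ∑ i, (if m i ≠ 0 then (d i : ℂ) * d i else 0) = c * 1 := by
        rw [mul_one, Finset.mul_sum]
        refine Eq.trans ?_ hEt
        refine Finset.sum_congr rfl fun i _ => ?_
        by_cases h : m i = 0
        · simp [h]
        · rw [if_pos h, (hm01 i h).2]; ring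
      have := mul_left_cancel₀ hc0 this
      exact_mod_cast this
    obtain ⟨i, -, hi⟩ := Finset.exists_ne_zero_of_sum_ne_zero (h1.trans_ne one_ne_zero)
    have hi' : m i ≠ 0 := by
      intro h; simp [h] at hi
    refine ⟨i, hi', ?_⟩
    have := Finset.single_le_sum (f := fun i => if m i ≠ 0 then d i * d i else 0)
      (fun j _ => Nat.zero_le _) (Finset.mem_univ i)
    rw [h1] at this
    simp only [if_pos hi'] at this
    have := hd i
    nlinarith
  have hni0 : n i0 = 1 := by
    have := hn i0
    rw [(hm01 i0 hi0).1 x, Matrix.trace_one, Fintype.card_fin, hdi0] at this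
    exact_mod_cast this.symm
  have key := arith_lemma d n hd i0 hdi0 hni0 H2 H1
  -- the structure constant
  set F := (Finset.univ : Finset (G × G)).filter
    (fun p => (p.2 * x * p.2⁻¹) * (p.1 * x * p.1⁻¹) * x = 1) with hF
  have H3 : c ^ 2 * ∑ i, (n i : ℂ) ^ 3 / d i = F.card * c := by
    have e1 : ∑ i, (d i : ℂ) *
        ((∑ g : G, ρ i (g * x * g⁻¹)) * (∑ g : G, ρ i (g * x * g⁻¹)) * ρ i x).trace
        = c ^ 2 * ∑ i, (n i : ℂ) ^ 3 / d i := by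
      rw [Finset.mul_sum]
      refine Finset.sum_congr rfl fun i _ => ?_
      rw [hl, Matrix.smul_mul, one_mul, Matrix.smul_mul, Matrix.smul_mul, one_mul,
        Matrix.trace_smul, Matrix.trace_smul, hn, smul_eq_mul, smul_eq_mul]
      have := hd0 i
      field_simp
      linear_combination (l i * d i + c * n i) * n i * hln i
    rw [← e1]
    simp only [Finset.sum_mul, Matrix.trace_sum, Finset.mul_sum, ← hmul]
    rw [Finset.sum_comm]
    simp only [Finset.sum_comm (s := (Finset.univ : Finset (Fin N))), hτ]
    rw [← Finset.sum_product' (f := fun g h : G =>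
      if (h * x * h⁻¹) * (g * x * g⁻¹) * x = 1 then c else 0), Finset.univ_product_univ,
      ← Finset.sum_filter, Finset.sum_const, nsmul_eq_mul]
  have hFc : F.card ≤ 9 := by
    set Z : Finset G := {1, x, x⁻¹}
    have : F ⊆ Z ×ˢ Z := by
      rintro ⟨h, g⟩ hp
      simp only [hF, Finset.mem_filter, Finset.mem_univ, true_and] at hp
      have hgh : ∀ k, k * x * k⁻¹ = x → k ∈ Z := by
        intro k hk
        have := hC k (mul_inv_eq_iff_eq_mul.1 hk)
        simpa [Z] using this
      obtain ⟨t, ht⟩ := hinv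
      have hA : g * x * g⁻¹ = x := by
        refine hN _ g (h * t) rfl ?_
        have e : x * (g * x * g⁻¹) * (h * x * h⁻¹) = 1 := by
          rw [mul_assoc, mul_eq_one_iff_inv_eq, ← mul_eq_one_iff_eq_inv.1 hp]
        rw [mul_eq_one_iff_eq_inv.1 e, show h * t * x * (h * t)⁻¹ = h * (t * x * t⁻¹) * h⁻¹ by group,
          ht]
        group
      have hB : h * x * h⁻¹ = x := by
        rw [hA, mul_assoc, mul_eq_one_iff_inv_eq, ← mul_inv_eq_iff_eq_mul] at hp
        rw [← hp, ← mul_inv_rev, hxx, inv_inv]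
      exact Finset.mem_product.2 ⟨hgh _ hB, hgh _ hA⟩
    calc F.card ≤ (Z ×ˢ Z).card := Finset.card_le_card this
      _ = Z.card * Z.card := Finset.card_product _ _
      _ ≤ 3 * 3 := Nat.mul_le_mul Finset.card_le_three Finset.card_le_three
  have H4 : (Fintype.card G : ℂ) * ∑ i, (n i : ℂ) ^ 3 / d i = F.card := by
    apply mul_left_cancel₀ hc0
    linear_combination H3
  have H5 : (Fintype.card G : ℝ) * ∑ i, (n i : ℝ) ^ 3 / d i = F.card := by
    exact_mod_cast H4
  have h9 : (F.card : ℝ) ≤ 9 := by exact_mod_cast hFc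
  have hpos : (0 : ℝ) ≤ Fintype.card G := by positivity
  have : (Fintype.card G : ℝ) ≤ 9 := by nlinarith
  exact_mod_cast this

theorem sol333 {G : Type*} [Group G] [Finite G] (a b : G) (ha : a ^ 3 = 1) (hb : b ^ 3 = 1)
    (hab : (a * b) ^ 3 = 1) : b ∈ Sol a := by
  have ha' : a * a = a⁻¹ := by rw [eq_inv_iff_mul_eq_one, ← pow_two, ← pow_succ, ha]
  have hb' : b * b = b⁻¹ := by rw [eq_inv_iff_mul_eq_one, ← pow_two, ← pow_succ, hb]
  have hai : a⁻¹ * a⁻¹ = a := by rw [← mul_inv_rev, ha', inv_inv]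
  have hbi : b⁻¹ * b⁻¹ = b := by rw [← mul_inv_rev, hb', inv_inv]
  have hm : a * b * a * b * a * b = 1 := by
    rw [← hab]; simp [pow_succ, mul_assoc]
  set p := a * b⁻¹ with hp
  set q := b⁻¹ * a with hq
  have hpq : p * q = a * b * a := by
    rw [hp, hq, show a * b⁻¹ * (b⁻¹ * a) = a * (b⁻¹ * b⁻¹) * a by group, hbi]
  have hqp : q * p = a * b * a := by
    have e1 : q * p = b⁻¹ * a⁻¹ * b⁻¹ := by
      rw [hp, hq, show b⁻¹ * a * (a * b⁻¹) = b⁻¹ * (a * a) * b⁻¹ by group, ha']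
    rw [e1, ← mul_inv_eq_one, ← inv_eq_one, ← hm]
    group
  have hcomm : p * q = q * p := hpq.trans hqp.symm
  have hA : Group.IsSolvable (closure {p, q}) := by
    letI : CommGroup (closure {p, q}) := Subgroup.closureCommGroupOfComm (by
      rintro u (rfl | rfl) v (rfl | rfl)
      · rfl
      · exact hcomm
      · exact hcomm.symm
      · rfl)
    exact Group.isSolvable_of_comm (fun u v => mul_comm u v)
  have hpA : p ∈ closure {p, q} := subset_closure (by simp)
  have hqA : q ∈ closure {p, q} := subset_closure (by simp)
  have hap : a⁻¹ * p * a = q := by rw [hp, hq]; group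
  have haq : a⁻¹ * q * a = (p * q)⁻¹ := by
    have e1 : a⁻¹ * q * a = a⁻¹ * b⁻¹ * a⁻¹ := by
      rw [hq, show a⁻¹ * (b⁻¹ * a) * a = a⁻¹ * b⁻¹ * (a * a) by group, ha']
    rw [e1, hpq]; group
  have hn : a⁻¹ ∈ normalizer (closure {p, q} : Set G) := by
    apply Subgroup.mem_normalizer_fintype
    intro n hn
    have hle : closure {p, q} ≤ (closure {p, q}).comap (MulAut.conj a⁻¹).toMonoidHom := by
      rw [Subgroup.closure_le]
      rintro u (rfl | rfl)
      · show a⁻¹ * p * a⁻¹⁻¹ ∈ closure {p, q}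
        rw [inv_inv, hap]; exact hqA
      · show a⁻¹ * q * a⁻¹⁻¹ ∈ closure {p, q}
        rw [inv_inv, haq]; exact inv_mem (mul_mem hpA hqA)
    exact hle hn
  have hs := solv_sup _ (zpowers a) hA (solv_zpowers a) (by
    rw [Subgroup.zpowers_le]; exact inv_mem_iff.1 hn)
  have haS : a ∈ zpowers a ⊔ closure {p, q} := le_sup_left (a := zpowers a) (mem_zpowers a)
  refine mem_Sol_of_le hs haS ?_
  have : b = p⁻¹ * a := by rw [hp]; group
  rw [this]
  exact mul_mem (inv_mem (le_sup_right (a := zpowers a) hpA)) haS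

theorem solv6 {G : Type*} [Group G] [Finite G] (h : Nat.card G = 6) : Group.IsSolvable G := by
  have : Fact (Nat.Prime 3) := ⟨Nat.prime_three⟩
  have : Fact (Nat.Prime 2) := ⟨Nat.prime_two⟩
  obtain ⟨z, hz⟩ := exists_prime_orderOf_dvd_card' (G := G) 3 (by rw [h]; norm_num)
  have hi : (zpowers z).index = 2 := by
    have := (zpowers z).card_mul_index
    rw [Nat.card_zpowers, hz, h] at this
    omega
  have := Subgroup.normal_of_index_eq_two hi
  rw [Group.isSolvable_iff_subgroup_quotient (zpowers z)]
  refine ⟨solv_zpowers z, ?_⟩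
  have hc : IsCyclic (G ⧸ zpowers z) := isCyclic_of_prime_card (p := 2) hi
  letI := hc.commGroup
  exact Group.isSolvable_of_comm (fun u v => mul_comm u v)

theorem zpowers_sub_Sol {G : Type*} [Group G] [Finite G] (x : G) :
    (zpowers x : Set G) ⊆ Sol x := by
  intro y hy
  exact mem_Sol_of_le (solv_zpowers x) (mem_zpowers x) hy

theorem ncard_zpowers {G : Type*} [Group G] (x : G) :
    (zpowers x : Set G).ncard = orderOf x := by
  rw [← Nat.card_coe_set_eq]; exact Nat.card_zpowers x

theorem finish6 {G : Type*} [Group G] [Finite G] {x z : G} (hS : (Sol x).ncard = 6)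
    (hz : orderOf z = 6) (hx : x ∈ zpowers z) : Group.IsSolvable G := by
  have h1 : Sol z ⊆ Sol x := fun y hy => Sol_anti hx hy
  have h2 : (zpowers z : Set G) = Sol x :=
    Set.eq_of_subset_of_ncard_le ((zpowers_sub_Sol z).trans h1) (by rw [hS, ncard_zpowers, hz])
      (Set.toFinite _)
  refine case6 z hz fun y hy => ?_
  have := h1 hy
  rw [← h2] at this
  exact this

theorem two_coset {G : Type*} [Group G] [Finite G] {x y : G} (hy : y ∈ Sol x)
    (hyZ : y ∉ zpowers x) :
    2 * orderOf x ≤ (Sol x).ncard ∧ ((Sol x).ncard = 2 * orderOf x →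
      ∀ s ∈ Sol x, s ∈ zpowers x ∨ s * y⁻¹ ∈ zpowers x) := by
  set Z : Set G := (zpowers x : Set G)
  set Y : Set G := (fun w => w * y) '' Z
  have hYn : Y.ncard = orderOf x := by
    rw [Set.ncard_image_of_injective _ (mul_left_injective y)]
    exact ncard_zpowers x
  have hdis : Disjoint Z Y := by
    rw [Set.disjoint_left]
    rintro _ h1 ⟨w, hw, rfl⟩
    exact hyZ (((zpowers x).mul_mem_cancel_left hw).1 h1)
  have hsub : Z ∪ Y ⊆ Sol x := by
    apply Set.union_subset (zpowers_sub_Sol x)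
    rintro _ ⟨w, hw, rfl⟩
    simpa using Sol_mul hy hw (one_mem _)
  have hc : (Z ∪ Y).ncard = 2 * orderOf x := by
    rw [Set.ncard_union_eq hdis (Set.toFinite _) (Set.toFinite _), hYn, ncard_zpowers, two_mul]
  refine ⟨hc ▸ Set.ncard_le_ncard hsub (Set.toFinite _), fun h s hs => ?_⟩
  have := Set.eq_of_subset_of_ncard_le hsub (by rw [hc, h]) (Set.toFinite _)
  rw [← this] at hs
  rcases hs with hs | ⟨w, hw, rfl⟩
  · left; exact hs
  · right; rw [mul_inv_cancel_right]; exact hw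

theorem cent_sub_Sol {G : Type*} [Group G] [Finite G] (x : G) :
    (centralizer {x} : Set G) ⊆ Sol x := by
  intro y hy
  exact mem_Sol_of_comm (Subgroup.mem_centralizer_singleton_iff.1 hy)

theorem case2 {G : Type*} [Group G] [Finite G] {x : G} (hS : (Sol x).ncard = 6)
    (hx : orderOf x = 2) : Group.IsSolvable G := by
  have : Fact (Nat.Prime 3) := ⟨Nat.prime_three⟩
  have hx1 : x ≠ 1 := by rintro rfl; simp at hx
  have hxx : x * x = 1 := by rw [← pow_two, ← hx, pow_orderOf_eq_one]
  set C := centralizer ({x} : Set G)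
  have hmem : ∀ g, g ∈ C ↔ g * x = x * g := fun g => Subgroup.mem_centralizer_singleton_iff
  have hCn : (C : Set G).ncard = Nat.card C := (Nat.card_coe_set_eq _).symm
  have hxC : x ∈ C := (hmem x).2 rfl
  have hle : Nat.card C ≤ 6 := by
    rw [← hCn, ← hS]; exact Set.ncard_le_ncard (cent_sub_Sol x) (Set.toFinite _)
  have hdvd : 2 ∣ Nat.card C := by
    rw [← hx, ← Nat.card_zpowers]
    exact Subgroup.card_dvd_of_le (by rwa [Subgroup.zpowers_le])
  have hpos : 0 < Nat.card C := Nat.card_pos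
  have : Nat.card C = 2 ∨ Nat.card C = 4 ∨ Nat.card C = 6 := by omega
  rcases this with h | h | h
  · refine selfcent2 x hxx hx1 fun g hg => ?_
    have e : ({1, x} : Set G) = C := by
      apply Set.eq_of_subset_of_ncard_le _ _ (Set.toFinite _)
      · rintro _ (rfl | rfl)
        · exact one_mem C
        · exact hxC
      · rw [hCn, h, Set.ncard_pair hx1.symm]
    have hg' : g ∈ (C : Set G) := (hmem g).2 hg
    rw [← e] at hg'
    simpa using hg'
  · exfalso
    obtain ⟨y, hy, hyC⟩ := Set.exists_mem_notMem_of_ncard_lt_ncard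
      (s := (C : Set G)) (t := Sol x) (by rw [hCn, h, hS]; norm_num) (Set.toFinite _)
    have hyx : y * x ≠ x * y := fun e => hyC ((hmem y).2 e)
    have hsub : (C : Set G) ∪ {y, x * y, y * x} ⊆ Sol x := by
      apply Set.union_subset (cent_sub_Sol x)
      rintro _ (rfl | rfl | rfl)
      · exact hy
      · simpa using Sol_mul hy (mem_zpowers x) (one_mem _)
      · simpa using Sol_mul hy (one_mem _) (mem_zpowers x)
    have hdis : Disjoint (C : Set G) {y, x * y, y * x} := by
      rw [Set.disjoint_right]
      rintro _ (rfl | rfl | rfl) h1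
      · exact hyC h1
      · exact hyC ((C.mul_mem_cancel_left hxC).1 h1)
      · exact hyC ((C.mul_mem_cancel_right hxC).1 h1)
    have h3 : ({y, x * y, y * x} : Set G).ncard = 3 := by
      rw [Set.ncard_eq_three]
      exact ⟨_, _, _, by simpa using hx1, by simpa using hx1, hyx.symm, rfl⟩
    have := Set.ncard_le_ncard hsub (Set.toFinite _)
    rw [Set.ncard_union_eq hdis (Set.toFinite _) (Set.toFinite _), hCn, h3, h, hS] at this
    omega
  · obtain ⟨⟨s, hs⟩, hs3⟩ := exists_prime_orderOf_dvd_card' (G := C) 3 (by rw [h]; norm_num)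
    rw [Subgroup.orderOf_mk] at hs3
    have hc : Commute x s := ((hmem s).1 hs).symm
    have ho : orderOf (x * s) = 6 := by
      rw [hc.orderOf_mul_eq_mul_orderOf_of_coprime (by rw [hx, hs3]; norm_num), hx, hs3]
    refine finish6 hS ho (mem_zpowers_iff.2 ⟨3, ?_⟩)
    rw [show (3 : ℤ) = (3 : ℕ) by rfl, zpow_natCast, hc.mul_pow, ← hs3, pow_orderOf_eq_one, hs3,
      pow_succ, pow_two, hxx, one_mul, mul_one]

theorem case3 {G : Type*} [Group G] [Finite G] {x : G} (hS : (Sol x).ncard = 6)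
    (hx : orderOf x = 3) : Group.IsSolvable G := by
  have : Fact (Nat.Prime 2) := ⟨Nat.prime_two⟩
  have hx1 : x ≠ 1 := by rintro rfl; simp at hx
  have hx3 : x ^ 3 = 1 := by rw [← hx, pow_orderOf_eq_one]
  have hxx : x * x = x⁻¹ := by rw [eq_inv_iff_mul_eq_one, ← pow_two, ← pow_succ, hx3]
  have hxi : x ≠ x⁻¹ := by
    intro h
    rw [← hxx] at h
    exact hx1 (by simpa using h)
  have hZ : ∀ w ∈ zpowers x, w = 1 ∨ w = x ∨ w = x⁻¹ := by
    intro w hw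
    classical
    rw [mem_zpowers_iff_mem_range_orderOf, hx] at hw
    simp only [Finset.mem_image, Finset.mem_range] at hw
    obtain ⟨k, hk, rfl⟩ := hw
    interval_cases k
    · simp
    · simp
    · right; right; rw [pow_two, hxx]
  have hZc : ∀ w ∈ zpowers x, w * x = x * w := by
    intro w hw
    rcases hZ w hw with rfl | rfl | rfl <;> simp
  obtain ⟨y, hy, hyZ⟩ := Set.exists_mem_notMem_of_ncard_lt_ncard
      (s := (zpowers x : Set G)) (t := Sol x) (by rw [ncard_zpowers, hx, hS]; norm_num)
      (Set.toFinite _)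
  have hcos := (two_coset hy hyZ).2 (by rw [hS, hx])
  have hyxy : y * x * y⁻¹ ∈ zpowers x := by
    have h1 : y * x ∈ Sol x := by simpa using Sol_mul hy (one_mem _) (mem_zpowers x)
    rcases hcos _ h1 with h | h
    · exact absurd (((zpowers x).mul_mem_cancel_right (mem_zpowers x)).1 h) hyZ
    · exact h
  -- the conjugation action of the second coset
  have hact : ∀ s, s * y⁻¹ ∈ zpowers x → s * x * s⁻¹ = y * x * y⁻¹ := by
    intro s hs
    have h1 : s * y⁻¹ * (y * x * y⁻¹) * (s * y⁻¹)⁻¹ = y * x * y⁻¹ := by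
      have hc : ∀ u ∈ zpowers x, ∀ v ∈ zpowers x, u * v = v * u := by
        intro u hu v hv
        exact congrArg Subtype.val (mul_comm' (⟨u, hu⟩ : zpowers x) ⟨v, hv⟩)
      rw [hc _ hs _ hyxy, mul_inv_cancel_right]
    rw [← h1]; group
  rcases hZ _ hyxy with h | h | h
  · exact absurd (by simpa using h) hx1
  · -- centralizer of order six
    set C := centralizer ({x} : Set G)
    have hmem : ∀ g, g ∈ C ↔ g * x = x * g := fun g => Subgroup.mem_centralizer_singleton_iff
    have hCS : (C : Set G) = Sol x := by
      apply Set.Subset.antisymm (cent_sub_Sol x)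
      intro s hs
      rcases hcos s hs with h' | h'
      · exact (hmem s).2 (hZc s h')
      · have := hact s h'
        rw [h] at this
        exact (hmem s).2 (mul_inv_eq_iff_eq_mul.1 this)
    have hC6 : Nat.card C = 6 := by
      rw [← hS, ← hCS]; exact (Nat.card_coe_set_eq _)
    obtain ⟨⟨s, hs⟩, hs2⟩ := exists_prime_orderOf_dvd_card' (G := C) 2 (by rw [hC6]; norm_num)
    rw [Subgroup.orderOf_mk] at hs2
    have hc : Commute x s := ((hmem s).1 hs).symm
    have ho : orderOf (x * s) = 6 := by
      rw [hc.orderOf_mul_eq_mul_orderOf_of_coprime (by rw [hx, hs2]; norm_num), hx, hs2]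
    refine finish6 hS ho (mem_zpowers_iff.2 ⟨4, ?_⟩)
    have hs2' : s ^ 2 = 1 := by rw [← hs2, pow_orderOf_eq_one]
    rw [show (4 : ℤ) = (4 : ℕ) by rfl, zpow_natCast, hc.mul_pow, pow_succ x 3, hx3,
      show s ^ 4 = (s ^ 2) ^ 2 by rw [← pow_mul], hs2']
    simp
  · -- self-centralizing and inverted
    have hC : ∀ g : G, g * x = x * g → g = 1 ∨ g = x ∨ g = x⁻¹ := by
      intro g hg
      rcases hcos g (mem_Sol_of_comm hg) with h' | h'
      · exact hZ g h'
      · have := hact g h'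
        rw [h, hg, mul_inv_cancel_right] at this
        exact absurd this hxi
    have hN : ∀ b g k : G, b = g * x * g⁻¹ → x * b = k * x * k⁻¹ → b = x := by
      intro b g k hb hk
      have hb3 : b ^ 3 = 1 := by rw [hb, conj_pow, hx3, mul_one, mul_inv_cancel]
      have hxb3 : (x * b) ^ 3 = 1 := by rw [hk, conj_pow, hx3, mul_one, mul_inv_cancel]
      rcases hcos b (sol333 x b hx3 hb3 hxb3) with h' | h'
      · rcases hZ b h' with e | e | e
        · rw [e] at hb
          exact absurd (by simpa using hb.symm) hx1
        · exact e
        · rw [e, mul_inv_cancel] at hk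
          exact absurd (by simpa using hk.symm) hx1
      · have e := hact b h'
        rw [h] at e
        have e2 : b * x⁻¹ * b⁻¹ = x := by
          rw [← conj_inv, e, inv_inv]
        have e3 : b ^ 3 * x * (b ^ 3)⁻¹ = x⁻¹ := by
          rw [show b ^ 3 * x * (b ^ 3)⁻¹ = b * (b * (b * x * b⁻¹) * b⁻¹) * b⁻¹ by
            simp [pow_succ, mul_assoc], e, e2, e]
        rw [hb3] at e3
        exact absurd (by simpa using e3) hxi
    have := Fintype.ofFinite G
    have h9 := char_lemma x hx3 hx1 ⟨y, h⟩ hC hN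
    rw [← Nat.card_eq_fintype_card] at h9
    set M := normalizer (zpowers x : Set G)
    have hMS : (M : Set G) = Sol x := by
      apply Set.Subset.antisymm
      · intro g hg
        exact mem_Sol_of_norm ((Subgroup.mem_normalizer_iff.1 hg x).1 (mem_zpowers x))
      · intro s hs
        have : s * x * s⁻¹ ∈ zpowers x := by
          rcases hcos s hs with h' | h'
          · rw [hZc s h', mul_inv_cancel_right]; exact mem_zpowers x
          · rw [hact s h']; exact hyxy
        exact zpowers_le_norm this (mem_zpowers s)
    have hM6 : Nat.card M = 6 := by
      rw [← hS, ← hMS]; exact (Nat.card_coe_set_eq _)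
    have hd : 6 ∣ Nat.card G := hM6 ▸ Subgroup.card_subgroup_dvd_card M
    have hpos : 0 < Nat.card G := Nat.card_pos
    exact solv6 (by omega)

theorem stmt14 {G : Type*} [Group G] [Finite G] (hG : ¬ IsSolvable G) (x : G) :
    Nat.card (Sol x) ≠ 6 := by
  intro hcard
  have hS : (Sol x).ncard = 6 := by rw [← Nat.card_coe_set_eq]; exact hcard
  apply hG
  show Group.IsSolvable G
  by_cases hsub : ∀ y ∈ Sol x, y ∈ zpowers x
  · have e : Sol x = zpowers x := Set.Subset.antisymm hsub (zpowers_sub_Sol x)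
    rw [e, ncard_zpowers] at hS
    exact case6 x hS hsub
  · push Not at hsub
    obtain ⟨y, hy, hyZ⟩ := hsub
    have h1 := (two_coset hy hyZ).1
    rw [hS] at h1
    have hpos := orderOf_pos x
    have : orderOf x = 1 ∨ orderOf x = 2 ∨ orderOf x = 3 := by omega
    rcases this with h | h | h
    · rw [orderOf_eq_one_iff] at h
      subst h
      have e : Sol (1 : G) = Set.univ :=
        Set.eq_univ_of_forall fun y => mem_Sol_of_comm (by simp)
      rw [e, Set.ncard_univ] at hS
      exact solv6 hS
    · exact case2 hS h
    · exact case3 hS h
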